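/- There exist absolute constants λ > 0 and c > 0 such that: for every f ∈ BMO(ℝ²) with ‖f‖_{BMO(ℝ²)} ≤ 1, every sequence of closed intervals I_k (k ≥ 1) with |I_k| = 2^k, and every closed interval J with |J| = 1, one has ∫_J exp( λ · sup_{k≥1} O(f_y, I_k)/k ) dy ≤ c, where f_y(t) = f(t,y) denotes the horizontal slice (which is integrable on each I_k for almost every y, so that the integrand is defined almost everywhere, with the convention exp(λ·∞) = ∞). -/

import Mathlib

open MeasureTheory Set Filter
open scoped ENNReal Topology

/-- Mean oscillation of `f : ℝ → ℝ` over `A ⊆ ℝ`. -/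
noncomputable def osc1 (f : ℝ → ℝ) (A : Set ℝ) : ℝ :=
  ⨍ x in A, |f x - ⨍ y in A, f y|

/-- Mean oscillation of `f : ℝ × ℝ → ℝ` over `E ⊆ ℝ²`. -/
noncomputable def osc2 (f : ℝ × ℝ → ℝ) (E : Set (ℝ × ℝ)) : ℝ :=
  ⨍ p in E, |f p - ⨍ q in E, f q|

/-- BMO(ℝ²) seminorm: supremum over closed axis-parallel squares of positive side length. -/
noncomputable def bmo2 (f : ℝ × ℝ → ℝ) : ℝ≥0∞ :=
  ⨆ (a : ℝ) (b : ℝ) (l : ℝ) (_ : 0 < l),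
    ENNReal.ofReal (osc2 f (Icc a (a + l) ×ˢ Icc b (b + l)))

/-- Half-open square. -/
def Sq (a b l : ℝ) : Set (ℝ × ℝ) := Ico a (a + l) ×ˢ Ico b (b + l)

/-- Average over the half-open square. -/
noncomputable def av (f : ℝ × ℝ → ℝ) (a b l : ℝ) : ℝ := (∫ p in Sq a b l, f p) / l ^ 2

/-- Dyadic conditional expectation of generation `n`. -/
noncomputable def dyF (f : ℝ × ℝ → ℝ) : ℕ → ℝ → ℝ → ℝ → ℝ × ℝ → ℝ
  | 0, a, b, l, _ => av f a b l
  | n + 1, a, b, l, x =>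
    if x.1 < a + l / 2 then
      if x.2 < b + l / 2 then dyF f n a b (l / 2) x else dyF f n a (b + l / 2) (l / 2) x
    else
      if x.2 < b + l / 2 then dyF f n (a + l / 2) b (l / 2) x
      else dyF f n (a + l / 2) (b + l / 2) (l / 2) x

lemma measurableSet_Sq (a b l : ℝ) : MeasurableSet (Sq a b l) :=
  measurableSet_Ico.prod measurableSet_Ico

lemma volume_Sq (a b l : ℝ) (hl : 0 < l) : volume (Sq a b l) = ENNReal.ofReal (l ^ 2) := by
  rw [Sq, Measure.volume_eq_prod, Measure.prod_prod, Real.volume_Ico, Real.volume_Ico]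
  simp only [add_sub_cancel_left]
  rw [← ENNReal.ofReal_mul hl.le, sq]

lemma volreal_Sq (a b l : ℝ) (hl : 0 < l) : volume.real (Sq a b l) = l ^ 2 := by
  rw [Measure.real, volume_Sq a b l hl, ENNReal.toReal_ofReal (by positivity)]

lemma Sq_ae_eq (a b l : ℝ) :
    (Sq a b l : Set (ℝ × ℝ)) =ᵐ[volume] (Icc a (a + l) ×ˢ Icc b (b + l) : Set (ℝ × ℝ)) := by
  rw [Sq, Measure.volume_eq_prod]
  exact Measure.set_prod_ae_eq Ico_ae_eq_Icc Ico_ae_eq_Icc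

lemma av_eq (f : ℝ × ℝ → ℝ) (a b l : ℝ) (hl : 0 < l) :
    (⨍ p in Icc a (a + l) ×ˢ Icc b (b + l), f p) = av f a b l := by
  rw [← setAverage_congr (Sq_ae_eq a b l), setAverage_eq, volreal_Sq a b l hl, av, smul_eq_mul]
  ring

lemma intOn_Sq {f : ℝ × ℝ → ℝ} (hf : LocallyIntegrable f volume) (a b l : ℝ) :
    IntegrableOn f (Sq a b l) volume :=
  (hf.integrableOn_isCompact (isCompact_Icc.prod isCompact_Icc)).mono_set
    (prod_mono Ico_subset_Icc_self Ico_subset_Icc_self :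
      Sq a b l ⊆ Icc a (a + l) ×ˢ Icc b (b + l))

lemma intOn_abs {f : ℝ × ℝ → ℝ} (hf : LocallyIntegrable f volume) (a b l m : ℝ) :
    IntegrableOn (fun p => |f p - m|) (Sq a b l) volume := by
  have : LocallyIntegrable (fun p => f p - m) volume :=
    hf.sub (locallyIntegrable_const m)
  exact (intOn_Sq this a b l).abs

lemma restrict_Sq (a b l : ℝ) (hl : 0 < l) :
    (volume.restrict (Sq a b l) : Measure (ℝ × ℝ)) =
      (volume.restrict (Sq a b (l / 2)) + volume.restrict (Sq a (b + l / 2) (l / 2))) +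
      (volume.restrict (Sq (a + l / 2) b (l / 2)) +
        volume.restrict (Sq (a + l / 2) (b + l / 2) (l / 2))) := by
  have hh : 0 < l / 2 := by positivity
  have key : ∀ c : ℝ, Ico c (c + l) = Ico c (c + l / 2) ∪ Ico (c + l / 2) (c + l / 2 + l / 2) := by
    intro c
    rw [Ico_union_Ico_eq_Ico (by linarith) (by linarith)]
    congr 1; ring
  have dj : ∀ c : ℝ, Disjoint (Ico c (c + l / 2)) (Ico (c + l / 2) (c + l / 2 + l / 2)) := by
    intro c
    rw [Set.disjoint_left]
    intro x h1 h2
    exact absurd h1.2 (not_lt.2 h2.1)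
  have e : Sq a b l = (Sq a b (l / 2) ∪ Sq a (b + l / 2) (l / 2)) ∪
      (Sq (a + l / 2) b (l / 2) ∪ Sq (a + l / 2) (b + l / 2) (l / 2)) := by
    simp only [Sq]
    rw [key a, key b, union_prod, prod_union, prod_union]
  rw [e, Measure.restrict_union, Measure.restrict_union, Measure.restrict_union]
  · exact Set.disjoint_prod.2 (Or.inr (dj b))
  · exact measurableSet_Sq _ _ _
  · exact Set.disjoint_prod.2 (Or.inr (dj b))
  · exact measurableSet_Sq _ _ _
  · simp only [Sq, ← prod_union]
    exact Set.disjoint_prod.2 (Or.inl (dj a))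
  · exact (measurableSet_Sq _ _ _).union (measurableSet_Sq _ _ _)

lemma integral_split {g : ℝ × ℝ → ℝ} (a b l : ℝ) (hl : 0 < l)
    (hg : IntegrableOn g (Sq a b l) volume) :
    ∫ p in Sq a b l, g p =
      ((∫ p in Sq a b (l / 2), g p) + ∫ p in Sq a (b + l / 2) (l / 2), g p) +
      ((∫ p in Sq (a + l / 2) b (l / 2), g p) +
        ∫ p in Sq (a + l / 2) (b + l / 2) (l / 2), g p) := by
  have h := hg
  rw [IntegrableOn, restrict_Sq a b l hl, integrable_add_measure, integrable_add_measure,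
    integrable_add_measure] at h
  obtain ⟨⟨h1, h2⟩, h3, h4⟩ := h
  rw [restrict_Sq a b l hl, integral_add_measure (h1.add_measure h2) (h3.add_measure h4),
    integral_add_measure h1 h2, integral_add_measure h3 h4]

lemma lintegral_split (g : ℝ × ℝ → ℝ≥0∞) (a b l : ℝ) (hl : 0 < l) :
    ∫⁻ p in Sq a b l, g p =
      ((∫⁻ p in Sq a b (l / 2), g p) + ∫⁻ p in Sq a (b + l / 2) (l / 2), g p) +
      ((∫⁻ p in Sq (a + l / 2) b (l / 2), g p) +
        ∫⁻ p in Sq (a + l / 2) (b + l / 2) (l / 2), g p) := by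
  rw [restrict_Sq a b l hl]
  simp only [lintegral_add_measure]

lemma measurable_dyF (f : ℝ × ℝ → ℝ) (n : ℕ) :
    ∀ a b l, Measurable (dyF f n a b l) := by
  induction n with
  | zero => intro a b l; simp only [dyF]; exact measurable_const
  | succ n ih =>
    intro a b l
    have h1 : MeasurableSet {x : ℝ × ℝ | x.1 < a + l / 2} :=
      measurableSet_lt measurable_fst measurable_const
    have h2 : MeasurableSet {x : ℝ × ℝ | x.2 < b + l / 2} :=
      measurableSet_lt measurable_snd measurable_const
    have : dyF f (n + 1) a b l = fun x => if x.1 < a + l / 2 then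
      if x.2 < b + l / 2 then dyF f n a b (l / 2) x else dyF f n a (b + l / 2) (l / 2) x
    else
      if x.2 < b + l / 2 then dyF f n (a + l / 2) b (l / 2) x
      else dyF f n (a + l / 2) (b + l / 2) (l / 2) x := by
      funext x; rw [dyF]
    rw [this]
    exact Measurable.ite h1 (Measurable.ite h2 (ih _ _ _) (ih _ _ _))
      (Measurable.ite h2 (ih _ _ _) (ih _ _ _))

lemma dyF_mem (f : ℝ × ℝ → ℝ) (n : ℕ) :
    ∀ a b l, 0 < l → ∀ x ∈ Sq a b l, ∃ a' b' : ℝ, x ∈ Sq a' b' (l / 2 ^ n) ∧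
      dyF f n a b l x = av f a' b' (l / 2 ^ n) := by
  induction n with
  | zero => intro a b l hl x hx; exact ⟨a, b, by simpa using hx, by simp [dyF]⟩
  | succ n ih =>
    intro a b l hl x hx
    have e : l / 2 ^ (n + 1) = l / 2 / 2 ^ n := by rw [pow_succ]; field_simp
    obtain ⟨⟨h1, h2⟩, h3, h4⟩ := hx
    rw [e, dyF]
    split_ifs with c1 c2 c2
    · exact ih _ _ _ (by positivity) x ⟨⟨h1, c1⟩, h3, c2⟩
    · exact ih _ _ _ (by positivity) x ⟨⟨h1, c1⟩, not_lt.1 c2, by linarith⟩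
    · exact ih _ _ _ (by positivity) x ⟨⟨not_lt.1 c1, by linarith⟩, h3, c2⟩
    · exact ih _ _ _ (by positivity) x ⟨⟨not_lt.1 c1, by linarith⟩, not_lt.1 c2, by linarith⟩

lemma av_sub {f : ℝ × ℝ → ℝ} (hf : LocallyIntegrable f volume) (a b l m : ℝ) (hl : 0 < l) :
    l ^ 2 * |av f a b l - m| ≤ ∫ p in Sq a b l, |f p - m| := by
  have h1 : ∫ p in Sq a b l, (f p - m) = l ^ 2 * (av f a b l - m) := by
    have hfin : volume (Sq a b l) ≠ ⊤ := by rw [volume_Sq a b l hl]; exact ENNReal.ofReal_ne_top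
    rw [integral_sub (intOn_Sq hf a b l) (integrableOn_const hfin), setIntegral_const,
      volreal_Sq a b l hl, av, smul_eq_mul]
    field_simp
  have h2 := abs_integral_le_integral_abs (f := fun p => f p - m) (μ := volume.restrict (Sq a b l))
  rw [h1, abs_mul, abs_of_nonneg (by positivity : (0 : ℝ) ≤ l ^ 2)] at h2
  exact h2

lemma child_bound {f : ℝ × ℝ → ℝ} (hf : LocallyIntegrable f volume)
    (H : ∀ a b l, 0 < l → ∫ p in Sq a b l, |f p - av f a b l| ≤ l ^ 2) (n : ℕ)
    (ih : ∀ a b l m, 0 < l → |av f a b l - m| ≤ 4 →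
      ∫⁻ p in Sq a b l, ENNReal.ofReal (Real.exp (|dyF f n a b l p - m| / 16)) ≤
        ENNReal.ofReal (2 * l ^ 2 + 2 * ∫ p in Sq a b l, |f p - m|))
    (a b l m : ℝ) (hl : 0 < l) (hm : |av f a b l - m| ≤ 8) :
    ∫⁻ p in Sq a b l, ENNReal.ofReal (Real.exp (|dyF f n a b l p - m| / 16)) ≤
        ENNReal.ofReal (2 * l ^ 2 + 2 * ∫ p in Sq a b l, |f p - m|) := by
  by_cases h4 : |av f a b l - m| ≤ 4
  · exact ih a b l m hl h4
  push Not at h4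
  have h0 := ih a b l (av f a b l) hl (by simp)
  have he : Real.exp (1 / 2) ≤ 2 := by
    have := Real.exp_one_lt_d9
    have h : Real.exp (1 / 2) * Real.exp (1 / 2) = Real.exp 1 := by
      rw [← Real.exp_add]; norm_num
    nlinarith [Real.exp_pos (1 / 2)]
  calc ∫⁻ p in Sq a b l, ENNReal.ofReal (Real.exp (|dyF f n a b l p - m| / 16))
      ≤ ∫⁻ p in Sq a b l, ENNReal.ofReal 2 *
          ENNReal.ofReal (Real.exp (|dyF f n a b l p - av f a b l| / 16)) := by
        refine lintegral_mono fun p => ?_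
        rw [← ENNReal.ofReal_mul (by norm_num)]
        apply ENNReal.ofReal_le_ofReal
        have : |dyF f n a b l p - m| ≤ |dyF f n a b l p - av f a b l| + |av f a b l - m| :=
          abs_sub_le _ _ _
        calc Real.exp (|dyF f n a b l p - m| / 16)
            ≤ Real.exp (1 / 2 + |dyF f n a b l p - av f a b l| / 16) :=
              Real.exp_le_exp.2 (by linarith)
          _ = Real.exp (1 / 2) * Real.exp (|dyF f n a b l p - av f a b l| / 16) := Real.exp_add _ _
          _ ≤ _ := by gcongr
    _ = ENNReal.ofReal 2 * ∫⁻ p in Sq a b l,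
          ENNReal.ofReal (Real.exp (|dyF f n a b l p - av f a b l| / 16)) :=
        lintegral_const_mul' _ _ ENNReal.ofReal_ne_top
    _ ≤ ENNReal.ofReal 2 *
          ENNReal.ofReal (2 * l ^ 2 + 2 * ∫ p in Sq a b l, |f p - av f a b l|) := by gcongr
    _ ≤ _ := by
        rw [← ENNReal.ofReal_mul (by norm_num)]
        apply ENNReal.ofReal_le_ofReal
        have := H a b l hl
        have h5 := av_sub hf a b l m hl
        have h6 : l ^ 2 * 4 ≤ l ^ 2 * |av f a b l - m| := by gcongr
        nlinarith [sq_nonneg l]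

lemma child_av {f : ℝ × ℝ → ℝ} (hf : LocallyIntegrable f volume)
    (H : ∀ a b l, 0 < l → ∫ p in Sq a b l, |f p - av f a b l| ≤ l ^ 2)
    (a b l m : ℝ) (hl : 0 < l) (hm : |av f a b l - m| ≤ 4) (a' b' : ℝ)
    (hsub : Sq a' b' (l / 2) ⊆ Sq a b l) : |av f a' b' (l / 2) - m| ≤ 8 := by
  have h1 := av_sub hf a' b' (l / 2) (av f a b l) (by positivity)
  have h2 : ∫ p in Sq a' b' (l / 2), |f p - av f a b l| ≤ ∫ p in Sq a b l, |f p - av f a b l| :=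
    setIntegral_mono_set (intOn_abs hf a b l _) (ae_of_all _ fun p => abs_nonneg _)
      hsub.eventuallyLE
  have h3 := H a b l hl
  have h4 : |av f a' b' (l / 2) - av f a b l| ≤ 4 := by
    have hl2 : 0 < l ^ 2 := by positivity
    by_contra h
    push Not at h
    nlinarith
  have := abs_sub_le (av f a' b' (l / 2)) (av f a b l) m
  linarith

lemma Sq_sub {a b l a' b' l' : ℝ} (h1 : a ≤ a') (h2 : a' + l' ≤ a + l) (h3 : b ≤ b')
    (h4 : b' + l' ≤ b + l) : Sq a' b' l' ⊆ Sq a b l :=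
  prod_mono (Ico_subset_Ico h1 h2) (Ico_subset_Ico h3 h4)

lemma dyadic_bound {f : ℝ × ℝ → ℝ} (hf : LocallyIntegrable f volume)
    (H : ∀ a b l, 0 < l → ∫ p in Sq a b l, |f p - av f a b l| ≤ l ^ 2) (n : ℕ) :
    ∀ a b l m, 0 < l → |av f a b l - m| ≤ 4 →
      ∫⁻ p in Sq a b l, ENNReal.ofReal (Real.exp (|dyF f n a b l p - m| / 16)) ≤
        ENNReal.ofReal (2 * l ^ 2 + 2 * ∫ p in Sq a b l, |f p - m|) := by
  induction n with
  | zero =>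
    intro a b l m hl hm
    simp only [dyF, lintegral_const, Measure.restrict_apply_univ]
    rw [volume_Sq a b l hl, ← ENNReal.ofReal_mul (Real.exp_pos _).le]
    apply ENNReal.ofReal_le_ofReal
    have he : Real.exp (|av f a b l - m| / 16) ≤ 2 := by
      have h1 : Real.exp (|av f a b l - m| / 16) ≤ Real.exp (1 / 2) :=
        Real.exp_le_exp.2 (by linarith)
      have := Real.exp_one_lt_d9
      have h : Real.exp (1 / 2) * Real.exp (1 / 2) = Real.exp 1 := by
        rw [← Real.exp_add]; norm_num
      nlinarith [Real.exp_pos (1 / 2)]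
    have h0 : 0 ≤ ∫ p in Sq a b l, |f p - m| := integral_nonneg fun p => abs_nonneg _
    nlinarith [sq_nonneg l]
  | succ n ih =>
    intro a b l m hl hm
    have hh : 0 < l / 2 := by positivity
    have cb := fun a' b' hs => child_bound hf H n ih a' b' (l / 2) m hh
      (child_av hf H a b l m hl hm a' b' hs)
    have c1 := cb a b (Sq_sub le_rfl (by linarith) le_rfl (by linarith))
    have c2 := cb a (b + l / 2) (Sq_sub le_rfl (by linarith) (by linarith) (by linarith))
    have c3 := cb (a + l / 2) b (Sq_sub (by linarith) (by linarith) le_rfl (by linarith))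
    have c4 := cb (a + l / 2) (b + l / 2)
      (Sq_sub (by linarith) (by linarith) (by linarith) (by linarith))
    rw [lintegral_split _ a b l hl, integral_split a b l hl (intOn_abs hf a b l m)]
    have nn : ∀ a' b', 0 ≤ 2 * (l / 2) ^ 2 + 2 * ∫ p in Sq a' b' (l / 2), |f p - m| := by
      intro a' b'
      have h0 : 0 ≤ ∫ p in Sq a' b' (l / 2), |f p - m| := integral_nonneg fun p => abs_nonneg _
      positivity
    have fin := add_le_add (add_le_add c1 c2) (add_le_add c3 c4)
    rw [← ENNReal.ofReal_add (nn _ _) (nn _ _), ← ENNReal.ofReal_add (nn _ _) (nn _ _),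
      ← ENNReal.ofReal_add (add_nonneg (nn _ _) (nn _ _)) (add_nonneg (nn _ _) (nn _ _))] at fin
    refine le_trans (le_of_eq ?_) (fin.trans (ENNReal.ofReal_le_ofReal (by nlinarith)))
    congr 2
    · refine setLIntegral_congr_fun (measurableSet_Sq _ _ _) fun p hp => ?_
      obtain ⟨⟨h1, h2⟩, h3, h4⟩ := hp
      simp only [dyF, if_pos h2, if_pos h4]
    · refine setLIntegral_congr_fun (measurableSet_Sq _ _ _) fun p hp => ?_
      obtain ⟨⟨h1, h2⟩, h3, h4⟩ := hp
      simp only [dyF, if_pos h2, if_neg (not_lt.2 h3)]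
    · refine setLIntegral_congr_fun (measurableSet_Sq _ _ _) fun p hp => ?_
      obtain ⟨⟨h1, h2⟩, h3, h4⟩ := hp
      simp only [dyF, if_neg (not_lt.2 h1), if_pos h4]
    · refine setLIntegral_congr_fun (measurableSet_Sq _ _ _) fun p hp => ?_
      obtain ⟨⟨h1, h2⟩, h3, h4⟩ := hp
      simp only [dyF, if_neg (not_lt.2 h1), if_neg (not_lt.2 h3)]

lemma dyF_tendsto {f : ℝ × ℝ → ℝ} (hf : LocallyIntegrable f volume) (a b l : ℝ) (hl : 0 < l) :
    ∀ᵐ x : ℝ × ℝ, x ∈ Sq a b l → Tendsto (fun n => dyF f n a b l x) atTop (𝓝 (f x)) := by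
  have : (volume : Measure (ℝ × ℝ)).IsAddHaarMeasure := by
    rw [Measure.volume_eq_prod]; infer_instance
  filter_upwards [IsUnifLocDoublingMeasure.ae_tendsto_average (volume : Measure (ℝ × ℝ)) hf 1]
    with x hx hxS
  choose A B hAB hF using fun n => dyF_mem f n a b l hl x hxS
  have hball : ∀ n, Metric.closedBall ((A n + l / 2 ^ n / 2, B n + l / 2 ^ n / 2) : ℝ × ℝ)
      (l / 2 ^ n / 2) = Icc (A n) (A n + l / 2 ^ n) ×ˢ Icc (B n) (B n + l / 2 ^ n) := by
    intro n
    rw [← closedBall_prod_same, Real.closedBall_eq_Icc, Real.closedBall_eq_Icc]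
    congr 2 <;> ring
  have hd : Tendsto (fun n : ℕ => l / 2 ^ n / 2) atTop (𝓝[>] 0) := by
    refine tendsto_nhdsWithin_iff.2 ⟨?_, Eventually.of_forall fun n => ?_⟩
    · have := (tendsto_pow_atTop_nhds_zero_of_lt_one (r := (1 / 2 : ℝ)) (by norm_num)
        (by norm_num)).const_mul (l / 2)
      rw [mul_zero] at this
      refine this.congr fun n => ?_
      rw [div_pow, one_pow]; ring
    · exact mem_Ioi.2 (by positivity)
  have := hx (l := atTop) (fun n => ((A n + l / 2 ^ n / 2, B n + l / 2 ^ n / 2) : ℝ × ℝ))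
    (fun n : ℕ => l / 2 ^ n / 2) hd (Eventually.of_forall fun n => by
      rw [one_mul, hball]
      exact prod_mono Ico_subset_Icc_self Ico_subset_Icc_self (hAB n))
  refine this.congr fun n => ?_
  rw [hball, av_eq f _ _ _ (by positivity), hF]

/-- John–Nirenberg inequality on squares. -/
lemma john_nirenberg {f : ℝ × ℝ → ℝ} (hf : LocallyIntegrable f volume)
    (H : ∀ a b l, 0 < l → ∫ p in Sq a b l, |f p - av f a b l| ≤ l ^ 2)
    (a b l : ℝ) (hl : 0 < l) :
    ∫⁻ p in Sq a b l, ENNReal.ofReal (Real.exp (|f p - av f a b l| / 16)) ≤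
      ENNReal.ofReal (4 * l ^ 2) := by
  have hb : ∀ n, ∫⁻ p in Sq a b l,
      ENNReal.ofReal (Real.exp (|dyF f n a b l p - av f a b l| / 16)) ≤
      ENNReal.ofReal (4 * l ^ 2) := fun n =>
    (dyadic_bound hf H n a b l _ hl (by simp)).trans
      (ENNReal.ofReal_le_ofReal (by linarith [H a b l hl]))
  calc ∫⁻ p in Sq a b l, ENNReal.ofReal (Real.exp (|f p - av f a b l| / 16))
      ≤ ∫⁻ p in Sq a b l, liminf (fun n =>
          ENNReal.ofReal (Real.exp (|dyF f n a b l p - av f a b l| / 16))) atTop := by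
        refine setLIntegral_mono_ae' (measurableSet_Sq _ _ _) ?_
        filter_upwards [dyF_tendsto hf a b l hl] with x hx hxS
        refine le_of_eq (Tendsto.liminf_eq ?_).symm
        refine (ENNReal.continuous_ofReal.tendsto _).comp ?_
        refine (Real.continuous_exp.tendsto _).comp ?_
        exact ((hx hxS).sub_const _).abs.div_const _
    _ ≤ liminf (fun n => ∫⁻ p in Sq a b l,
          ENNReal.ofReal (Real.exp (|dyF f n a b l p - av f a b l| / 16))) atTop := by
        refine lintegral_liminf_le fun n => ?_
        have := measurable_dyF f n a b l
        fun_prop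
    _ ≤ liminf (fun _ : ℕ => ENNReal.ofReal (4 * l ^ 2)) atTop :=
        liminf_le_liminf (Eventually.of_forall hb)
    _ = _ := by simp

lemma slice_bound (h : ℝ → ℝ) (hm : Measurable h) (c a L : ℝ) (hL : 0 < L) :
    ENNReal.ofReal (Real.exp (osc1 h (Icc a (a + L)) / 32)) ≤
      ENNReal.ofReal L⁻¹ *
        ∫⁻ t in Icc a (a + L), ENNReal.ofReal (Real.exp (|h t - c| / 16)) := by
  by_cases hE : ∫⁻ t in Icc a (a + L), ENNReal.ofReal (Real.exp (|h t - c| / 16)) = ⊤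
  · rw [hE, ENNReal.mul_top]
    · exact le_top
    · simpa using hL
  have hv : volume.real (Icc a (a + L)) = L := by
    rw [Measure.real, Real.volume_Icc, add_sub_cancel_left, ENNReal.toReal_ofReal hL.le]
  have hvt : volume (Icc a (a + L)) ≠ ⊤ := by
    rw [Real.volume_Icc]; exact ENNReal.ofReal_ne_top
  have hv0 : volume (Icc a (a + L)) ≠ 0 := by
    rw [Real.volume_Icc, add_sub_cancel_left]; simpa using hL
  have hexp : IntegrableOn (fun t => Real.exp (|h t - c| / 16)) (Icc a (a + L)) volume := by
    refine ⟨by fun_prop, ?_⟩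
    rw [hasFiniteIntegral_iff_ofReal (ae_of_all _ fun t => (Real.exp_pos _).le)]
    exact lt_top_iff_ne_top.2 hE
  have habs : IntegrableOn (fun t => |h t - c| / 16) (Icc a (a + L)) volume := by
    refine Integrable.mono' hexp (by fun_prop) (ae_of_all _ fun t => ?_)
    rw [Real.norm_eq_abs, abs_of_nonneg (by positivity)]
    linarith [Real.add_one_le_exp (|h t - c| / 16)]
  have habs' : IntegrableOn (fun t => |h t - c|) (Icc a (a + L)) volume := by
    have := habs.mul_const 16
    refine this.congr (ae_of_all _ fun t => ?_)
    simp
  have hsub : IntegrableOn (fun t => h t - c) (Icc a (a + L)) volume := by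
    refine Integrable.mono' habs' (by fun_prop) (ae_of_all _ fun t => ?_)
    rw [Real.norm_eq_abs]
  have hint : IntegrableOn h (Icc a (a + L)) volume := by
    have := hsub.add (integrableOn_const (C := c) hvt)
    refine this.congr (ae_of_all _ fun t => ?_)
    simp
  set m := ⨍ t in Icc a (a + L), h t with hmdef
  have hmc : |m - c| ≤ L⁻¹ * ∫ t in Icc a (a + L), |h t - c| := by
    have e : m - c = L⁻¹ * ∫ t in Icc a (a + L), (h t - c) := by
      rw [integral_sub hint (integrableOn_const hvt), setIntegral_const, hv, hmdef, setAverage_eq,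
        hv, smul_eq_mul, smul_eq_mul]
      field_simp
    rw [e, abs_mul, abs_of_pos (inv_pos.2 hL)]
    gcongr
    exact abs_integral_le_integral_abs
  have hosc : osc1 h (Icc a (a + L)) ≤ 2 * (L⁻¹ * ∫ t in Icc a (a + L), |h t - c|) := by
    rw [osc1, setAverage_eq, hv, smul_eq_mul, ← hmdef]
    have h1 : ∫ t in Icc a (a + L), |h t - m| ≤
        ∫ t in Icc a (a + L), (|h t - c| + |m - c|) := by
      refine integral_mono ?_ (habs'.add (integrableOn_const hvt)) fun t => ?_
      · exact (hint.sub (integrableOn_const hvt)).abs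
      · have := abs_sub_le (h t) c m
        rw [abs_sub_comm c m] at this
        exact this
    rw [integral_add habs' (integrableOn_const hvt), setIntegral_const, hv, smul_eq_mul] at h1
    calc L⁻¹ * ∫ t in Icc a (a + L), |h t - m|
        ≤ L⁻¹ * ((∫ t in Icc a (a + L), |h t - c|) + L * |m - c|) := by gcongr
      _ = L⁻¹ * (∫ t in Icc a (a + L), |h t - c|) + |m - c| := by field_simp
      _ ≤ _ := by linarith
  have hJ := ConvexOn.map_set_average_le (μ := volume) convexOn_exp
    Real.continuous_exp.continuousOn isClosed_univ hv0 hvt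
    (ae_of_all _ fun t => mem_univ _) habs hexp
  rw [setAverage_eq, setAverage_eq, hv, smul_eq_mul, smul_eq_mul, integral_div] at hJ
  rw [← ofReal_integral_eq_lintegral_ofReal hexp (ae_of_all _ fun t => (Real.exp_pos _).le),
    ← ENNReal.ofReal_mul (inv_pos.2 hL).le]
  apply ENNReal.ofReal_le_ofReal
  refine le_trans (Real.exp_le_exp.2 ?_) hJ
  linarith

lemma pointwise_bound (X : ℝ) (hX : 0 ≤ X) (k : ℕ) (hk : 1 ≤ k) :
    Real.exp (1 / 64 * X / k) ≤ 4 + (1 / 4) ^ k * Real.exp (X / 32) := by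
  have hk' : (1 : ℝ) ≤ k := by exact_mod_cast hk
  by_cases h : Real.exp (X / 64) ≤ 4 ^ k
  · have h1 : Real.exp (1 / 64 * X / k) ^ k ≤ 4 ^ k := by
      rw [← Real.exp_nat_mul]
      refine le_trans (le_of_eq ?_) h
      congr 1; field_simp
    have h2 := le_of_pow_le_pow_left₀ (by omega) (by norm_num) h1
    have : 0 ≤ (1 / 4 : ℝ) ^ k * Real.exp (X / 32) := by positivity
    linarith
  · push Not at h
    have h1 : Real.exp (1 / 64 * X / k) ≤ Real.exp (X / 64) := by
      apply Real.exp_le_exp.2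
      rw [div_le_iff₀ (by linarith)]
      nlinarith
    have h2 : Real.exp (X / 32) = Real.exp (X / 64) * Real.exp (X / 64) := by
      rw [← Real.exp_add]; congr 1; ring
    have h3 : (1 / 4 : ℝ) ^ k * 4 ^ k = 1 := by rw [← mul_pow]; norm_num
    have h4 : Real.exp (X / 64) ≤ (1 / 4) ^ k * Real.exp (X / 32) := by
      rw [h2]
      calc Real.exp (X / 64) = (1 / 4 : ℝ) ^ k * (4 ^ k * Real.exp (X / 64)) := by
            rw [← mul_assoc, h3, one_mul]
        _ ≤ _ := by gcongr
    linarith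

lemma osc1_nonneg (f : ℝ → ℝ) (A : Set ℝ) : 0 ≤ osc1 f A := by
  rw [osc1, setAverage_eq]
  exact mul_nonneg (by positivity) (integral_nonneg fun x => abs_nonneg _)

lemma level_bound {g : ℝ × ℝ → ℝ} (hg : Measurable g) (hf : LocallyIntegrable g volume)
    (H : ∀ a b l, 0 < l → ∫ p in Sq a b l, |g p - av g a b l| ≤ l ^ 2)
    (a b L : ℝ) (hL : 1 < L) :
    ∫⁻ y in Icc b (b + 1), ENNReal.ofReal L⁻¹ * ∫⁻ t in Icc a (a + L),
      ENNReal.ofReal (Real.exp (|g (t, y) - av g a b L| / 16)) ≤ ENNReal.ofReal (4 * L) := by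
  have hL0 : 0 < L := by linarith
  rw [lintegral_const_mul' _ _ ENNReal.ofReal_ne_top]
  have hmeas : Measurable fun p : ℝ × ℝ =>
      ENNReal.ofReal (Real.exp (|g p - av g a b L| / 16)) := by fun_prop
  have hjn := john_nirenberg hf H a b L hL0
  rw [Sq, Measure.volume_eq_prod, ← Measure.prod_restrict, lintegral_prod_symm' _ hmeas] at hjn
  calc _ ≤ ENNReal.ofReal L⁻¹ * ∫⁻ y in Ico b (b + L), ∫⁻ t in Ico a (a + L),
        ENNReal.ofReal (Real.exp (|g (t, y) - av g a b L| / 16)) := by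
        refine mul_le_mul_right ?_ _
        have e : (volume.restrict (Ico a (a + L)) : Measure ℝ) = volume.restrict (Icc a (a + L)) :=
          Measure.restrict_congr_set Ico_ae_eq_Icc
        rw [e]
        refine lintegral_mono_set fun y hy => ⟨hy.1, by linarith [hy.2]⟩
    _ ≤ ENNReal.ofReal L⁻¹ * ENNReal.ofReal (4 * L ^ 2) := by gcongr
    _ = _ := by
        rw [← ENNReal.ofReal_mul (by positivity)]
        congr 1
        field_simp

theorem main_meas {g : ℝ × ℝ → ℝ} (hg : Measurable g) (hf : LocallyIntegrable g volume)
    (H : ∀ a b l, 0 < l → ∫ p in Sq a b l, |g p - av g a b l| ≤ l ^ 2)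
    (a : ℕ → ℝ) (b : ℝ) :
    (∫⁻ y in Icc b (b + 1),
          ⨆ (k : ℕ) (_ : 1 ≤ k),
            ENNReal.ofReal
              (Real.exp (1 / 64 * osc1 (fun t => g (t, y)) (Icc (a k) (a k + 2 ^ k)) / k)))
          ≤ ENNReal.ofReal 12 := by
  set G : ℕ → ℝ → ℝ≥0∞ := fun k y => ENNReal.ofReal (2 ^ k)⁻¹ *
    ∫⁻ t in Icc (a k) (a k + 2 ^ k),
      ENNReal.ofReal (Real.exp (|g (t, y) - av g (a k) b (2 ^ k)| / 16)) with hG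
  have hGm : ∀ k, Measurable (G k) := by
    intro k
    refine Measurable.const_mul ?_ _
    exact Measurable.lintegral_prod_left' (f := fun p : ℝ × ℝ =>
      ENNReal.ofReal (Real.exp (|g p - av g (a k) b (2 ^ k)| / 16))) (by fun_prop)
  calc _ ≤ ∫⁻ y in Icc b (b + 1), (ENNReal.ofReal 4 +
        ∑' k : ℕ, ENNReal.ofReal ((1 / 4) ^ (k + 1)) * G (k + 1) y) := by
        refine lintegral_mono fun y => iSup₂_le fun k hk => ?_
        refine (ENNReal.ofReal_le_ofReal (pointwise_bound _ (osc1_nonneg _ _) k hk)).trans ?_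
        rw [ENNReal.ofReal_add (by norm_num) (by positivity)]
        gcongr
        rw [ENNReal.ofReal_mul (by positivity)]
        obtain ⟨j, rfl⟩ : ∃ j, k = j + 1 := ⟨k - 1, by omega⟩
        refine le_trans ?_ (ENNReal.le_tsum j)
        gcongr
        exact slice_bound (fun t => g (t, y)) (by fun_prop) _ _ _ (by positivity)
    _ = ENNReal.ofReal 4 + ∑' k : ℕ, ∫⁻ y in Icc b (b + 1),
          ENNReal.ofReal ((1 / 4) ^ (k + 1)) * G (k + 1) y := by
        rw [lintegral_add_left measurable_const, lintegral_tsum fun k =>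
          ((hGm (k + 1)).const_mul _).aemeasurable]
        simp
    _ ≤ ENNReal.ofReal 4 + ∑' k : ℕ, ENNReal.ofReal (4 * (1 / 2) ^ (k + 1)) := by
        gcongr with k
        rw [lintegral_const_mul' _ _ ENNReal.ofReal_ne_top]
        have := level_bound hg hf H (a (k + 1)) b (2 ^ (k + 1))
          (one_lt_pow₀ (by norm_num) (by omega))
        refine (mul_le_mul_right this _).trans ?_
        rw [← ENNReal.ofReal_mul (by positivity)]
        apply ENNReal.ofReal_le_ofReal
        have : (1 / 4 : ℝ) ^ (k + 1) * 2 ^ (k + 1) = (1 / 2) ^ (k + 1) := by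
          rw [← mul_pow]; norm_num
        rw [← this]
        apply le_of_eq; ring
    _ ≤ ENNReal.ofReal 12 := by
        have hs : HasSum (fun k : ℕ => 4 * (1 / 2 : ℝ) ^ (k + 1)) 4 := by
          have := hasSum_geometric_two.mul_left 2
          have e : (fun k : ℕ => 4 * (1 / 2 : ℝ) ^ (k + 1)) = fun k => 2 * (1 / 2 : ℝ) ^ k := by
            funext k; rw [pow_succ]; ring
          rw [e]
          norm_num at this ⊢
          exact this
        rw [← ENNReal.ofReal_tsum_of_nonneg (fun k => by positivity) hs.summable, hs.tsum_eq,
          ← ENNReal.ofReal_add (by norm_num) (by norm_num)]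
        exact ENNReal.ofReal_le_ofReal (by norm_num)


/-- there are absolute constants `λ, c > 0` such that for every
`f ∈ BMO(ℝ²)` with `‖f‖_{BMO(ℝ²)} ≤ 1`, every sequence of closed intervals
`I_k = [a k, a k + 2^k]` (`k ≥ 1`) of length `2^k`, and every closed interval `J` of
length `1`, one has `∫_J exp(λ · sup_{k≥1} O(f_y, I_k)/k) dy ≤ c`, where the
exponential of the supremum (a value in `[0,∞]`) is expressed as the supremum in
`[0,∞]` of the exponentials. -/
theorem exp_sup_slice_oscillation_integral :
    ∃ lam c : ℝ, 0 < lam ∧ 0 < c ∧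
      ∀ f : ℝ × ℝ → ℝ, LocallyIntegrable f volume → bmo2 f ≤ 1 →
      ∀ a : ℕ → ℝ, ∀ b : ℝ,
        (∫⁻ y in Icc b (b + 1),
          ⨆ (k : ℕ) (_ : 1 ≤ k),
            ENNReal.ofReal
              (Real.exp (lam * osc1 (fun t => f (t, y)) (Icc (a k) (a k + 2 ^ k)) / k)))
          ≤ ENNReal.ofReal c := by
  refine ⟨1 / 64, 12, by norm_num, by norm_num, ?_⟩
  intro f hf hbmo a b
  have hae := hf.aestronglyMeasurable
  set g := hae.mk f with hgdef
  have hg : Measurable g := hae.stronglyMeasurable_mk.measurable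
  have hfg : f =ᵐ[volume] g := hae.ae_eq_mk
  have hgl : LocallyIntegrable g volume := by
    intro x
    obtain ⟨U, hU, hi⟩ := hf x
    exact ⟨U, hU, hi.congr (ae_restrict_of_ae hfg)⟩
  have H : ∀ a b l, 0 < l → ∫ p in Sq a b l, |g p - av g a b l| ≤ l ^ 2 := by
    intro a b l hl
    have h1 : ENNReal.ofReal (osc2 f (Icc a (a + l) ×ˢ Icc b (b + l))) ≤ 1 :=
      le_trans (le_iSup_of_le a (le_iSup_of_le b (le_iSup_of_le l
        (le_iSup (fun _ : 0 < l => ENNReal.ofReal (osc2 f (Icc a (a + l) ×ˢ Icc b (b + l))))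
          hl)))) hbmo
    rw [ENNReal.ofReal_le_one, osc2, av_eq f a b l hl,
      av_eq (fun p => |f p - av f a b l|) a b l hl, av, div_le_one (by positivity)] at h1
    have h2 : av f a b l = av g a b l := by
      rw [av, av, integral_congr_ae (ae_restrict_of_ae hfg)]
    rw [h2] at h1
    refine le_trans (le_of_eq ?_) h1
    refine integral_congr_ae (ae_restrict_of_ae ?_)
    filter_upwards [hfg] with p hp
    rw [hp]
  refine le_trans (le_of_eq ?_) (main_meas hg hgl H a b)
  refine lintegral_congr_ae (ae_restrict_of_ae ?_)
  have hsw : ∀ᵐ y : ℝ, ∀ᵐ t : ℝ, f (t, y) = g (t, y) := by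
    have h1 : ∀ᵐ q : ℝ × ℝ ∂(volume.prod volume), f q.swap = g q.swap := by
      have := hfg
      rw [Filter.EventuallyEq, Measure.volume_eq_prod, ← Measure.prod_swap] at this
      exact ae_of_ae_map measurable_swap.aemeasurable this
    exact Measure.ae_ae_of_ae_prod h1
  filter_upwards [hsw] with y hy
  have : ∀ A : Set ℝ, osc1 (fun t => f (t, y)) A = osc1 (fun t => g (t, y)) A := by
    intro A
    have e1 : (⨍ t in A, f (t, y)) = ⨍ t in A, g (t, y) := average_congr (ae_restrict_of_ae hy)
    simp only [osc1]
    rw [e1]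
    refine average_congr (ae_restrict_of_ae ?_)
    filter_upwards [hy] with t ht
    rw [ht]
  simp only [this]
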